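/- arXiv:2310.12596 — 11 statements merged into one kernel-verified Lean document; each statement's English description precedes it below -/
import Mathlib

section
/- Let V be a two-dimensional real inner product space with inner product h and let J ∈ End(V) satisfy J² = −id and h(Jv, Jw) = h(v,w) for all v,w. Let T : V × V × V × V → ℝ be a totally symmetric quadrilinear form, let U : V × V → End(V) satisfy h(U(X,Y)Z, W) = T(X,Y,Z,W) for all X,Y,Z,W, and define q : V⁴ → ℂ by q(X,Y,Z,W) = T(X,Y,Z,W) − i·T(X,Y,Z,JW). Then the following are equivalent: (a) for all X,Y ∈ V the endomorphism U(X,Y) is trace-free and U(JX,Y) = U(X,JY) = U(X,Y)∘J; (b) q is complex quadri-linear with respect to J, i.e. q(JX,Y,Z,W) = q(X,JY,Z,W) = q(X,Y,JZ,W) = q(X,Y,Z,JW) = i·q(X,Y,Z,W) for all X,Y,Z,W ∈ V. -/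
open scoped InnerProductSpace

/-- For a compatible complex structure `J` on a two-dimensional real
inner product space, a totally symmetric quadrilinear form `T` with associated
`(1,3)`-tensor `U` and complex form `q = T(·,·,·,·) − i·T(·,·,·,J·)`, the tensor
`U` is trace-free and commutes appropriately with `J` iff `q` is complex
quadri-linear with respect to `J`. -/
theorem traceless_J_compatible_iff_q_complex_quadrilinear
    {V : Type*} [NormedAddCommGroup V] [InnerProductSpace ℝ V]
    (hdim : Module.finrank ℝ V = 2)
    (J : V →ₗ[ℝ] V) (hJ2 : ∀ v : V, J (J v) = -v)
    (hJh : ∀ v w : V, ⟪J v, J w⟫_ℝ = ⟪v, w⟫_ℝ)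
    (T : V → V → V → V → ℝ)
    (hsymm : ∀ (v : Fin 4 → V) (σ : Equiv.Perm (Fin 4)),
      T (v (σ 0)) (v (σ 1)) (v (σ 2)) (v (σ 3)) = T (v 0) (v 1) (v 2) (v 3))
    (U : V → V → (V →ₗ[ℝ] V))
    (hrel : ∀ X Y Z W : V, ⟪U X Y Z, W⟫_ℝ = T X Y Z W)
    (q : V → V → V → V → ℂ)
    (hq : ∀ X Y Z W : V,
      q X Y Z W = (T X Y Z W : ℂ) - Complex.I * (T X Y Z (J W) : ℂ)) :
    (∀ X Y : V, LinearMap.trace ℝ V (U X Y) = 0 ∧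
        U (J X) Y = U X (J Y) ∧ U X (J Y) = (U X Y) ∘ₗ J) ↔
    (∀ X Y Z W : V,
        q (J X) Y Z W = Complex.I * q X Y Z W ∧
        q X (J Y) Z W = Complex.I * q X Y Z W ∧
        q X Y (J Z) W = Complex.I * q X Y Z W ∧
        q X Y Z (J W) = Complex.I * q X Y Z W) := by
  have inner_J_left (v w : V) : ⟪J v, w⟫_ℝ = -⟪v, J w⟫_ℝ := by
    rw [← hJh v (J w), hJ2, inner_neg_right, neg_neg]
  have hneg (X Y Z W : V) : T X Y Z (-W) = -T X Y Z W := by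
    rw [← hrel, ← hrel, inner_neg_right]
  have swap_first_last (X Y Z W : V) : T W Y Z X = T X Y Z W :=
    hsymm ![X, Y, Z, W] (Equiv.swap 0 3)
  constructor
  · intro h
    have move_first (X Y Z W : V) : T (J X) Y Z W = T X Y (J Z) W := by
      rw [← hrel, (h X Y).2.1, (h X Y).2.2, LinearMap.comp_apply, hrel]
    have move_second (X Y Z W : V) : T X (J Y) Z W = T X Y (J Z) W := by
      rw [← hrel, (h X Y).2.2, LinearMap.comp_apply, hrel]
    have move_third (X Y Z W : V) : T X Y (J Z) W = T X Y Z (J W) := by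
      rw [← swap_first_last X Y Z (J W), move_first, swap_first_last]
    intro X Y Z W
    simp only [hq, move_first, move_second, move_third, hJ2, hneg]
    have key : (T X Y Z (J W) : ℂ) - Complex.I * ((-T X Y Z W : ℝ) : ℂ) =
        Complex.I * ((T X Y Z W : ℂ) - Complex.I * (T X Y Z (J W) : ℂ)) := by
      push_cast
      linear_combination (T X Y Z (J W) : ℂ) * Complex.I_mul_I
    exact ⟨key, key, key, key⟩
  · intro h
    have re_q (X Y Z W : V) : (q X Y Z W).re = T X Y Z W := by simp [hq]
    have re_I_mul_q (X Y Z W : V) : (Complex.I * q X Y Z W).re = T X Y Z (J W) := by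
      simp [hq]
    have move_first (X Y Z W : V) : T (J X) Y Z W = T X Y Z (J W) := by
      rw [← re_q, (h X Y Z W).1, re_I_mul_q]
    have move_second (X Y Z W : V) : T X (J Y) Z W = T X Y Z (J W) := by
      rw [← re_q, (h X Y Z W).2.1, re_I_mul_q]
    have move_third (X Y Z W : V) : T X Y (J Z) W = T X Y Z (J W) := by
      rw [← re_q, (h X Y Z W).2.2.1, re_I_mul_q]
    intro X Y
    refine ⟨?_, ?_, ?_⟩
    · have hJUJ : J * (U X Y * J) = U X Y := by
        ext Z
        refine ext_inner_right ℝ fun W => ?_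
        simp only [Module.End.mul_apply]
        rw [inner_J_left, hrel, hrel, move_third, hJ2, hneg, neg_neg]
      have hUJJ : U X Y * J * J = -U X Y := by
        ext Z
        simp [Module.End.mul_apply, hJ2]
      have htrace := LinearMap.trace_mul_comm ℝ J (U X Y * J)
      rw [hJUJ, hUJJ, map_neg] at htrace
      linarith
    · ext Z
      refine ext_inner_right ℝ fun W => ?_
      rw [hrel, hrel, move_first, move_second]
    · ext Z
      refine ext_inner_right ℝ fun W => ?_
      rw [LinearMap.comp_apply, hrel, hrel, move_second, move_third]
end

section
/- Let e₁,e₂ be the standard basis of ℝ² and J₀ the standard complex structure (J₀e₁ = e₂, J₀e₂ = −e₁). Let T be a C¹ family, parametrized by p = (x,y) ∈ ℝ², of quadrilinear forms T_p : (ℝ²)⁴ → ℝ such that each T_p is totally symmetric and satisfies T_p(J₀X, J₀Y, Z, W) = −T_p(X,Y,Z,W) for all X,Y,Z,W. Define f : ℂ → ℂ by f(x+iy) = T_{(x,y)}(e₁,e₁,e₁,e₁) − i·T_{(x,y)}(e₁,e₁,e₁,e₂). Then the Codazzi equations ∂ₓ(T_p(e₂,a,b,c)) = ∂_y(T_p(e₁,a,b,c))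 for all a,b,c ∈ {e₁,e₂} hold on ℝ² if and only if f is holomorphic on ℂ. -/
/-- The standard complex structure `J₀` on `ℝ²`: `J₀e₁ = e₂`, `J₀e₂ = −e₁`. -/
noncomputable def J0 : ℝ × ℝ → ℝ × ℝ := fun p => (-p.2, p.1)

/-- The Cauchy–Riemann equations for the function `u - i v`. -/
lemma differentiableAt_sub_I_mul_iff {u v : ℝ × ℝ → ℝ} {f : ℂ → ℂ}
    (hf : ∀ z : ℂ, f z = (u (z.re, z.im) : ℂ) - Complex.I * (v (z.re, z.im) : ℂ)) (z : ℂ)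
    (hu : DifferentiableAt ℝ u (z.re, z.im)) (hv : DifferentiableAt ℝ v (z.re, z.im)) :
    DifferentiableAt ℂ f z ↔
      fderiv ℝ v (z.re, z.im) (1, 0) = fderiv ℝ u (z.re, z.im) (0, 1) ∧
        fderiv ℝ u (z.re, z.im) (1, 0) = -fderiv ℝ v (z.re, z.im) (0, 1) := by
  have lift_real {w : ℝ × ℝ → ℝ} (hw : DifferentiableAt ℝ w (z.re, z.im)) :
      HasFDerivAt (fun z : ℂ => (w (z.re, z.im) : ℂ))
        (Complex.ofRealCLM.comp ((fderiv ℝ w (z.re, z.im)).comp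
          (Complex.equivRealProdCLM : ℂ →L[ℝ] ℝ × ℝ))) z :=
    Complex.ofRealCLM.hasFDerivAt.comp z
      (HasFDerivAt.comp (g := w) z hw.hasFDerivAt Complex.equivRealProdCLM.hasFDerivAt)
  have hd := (lift_real hu).sub ((lift_real hv).const_mul Complex.I)
  have hfun : f = (fun z : ℂ => (u (z.re, z.im) : ℂ)) -
      fun z : ℂ => Complex.I * (v (z.re, z.im) : ℂ) := funext hf
  rw [← hfun] at hd
  rw [differentiableAt_complex_iff_differentiableAt_real, hd.fderiv,
    and_iff_right hd.differentiableAt]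
  simp [Complex.ext_iff, Complex.equivRealProdCLM_apply]
  grind

/-- A symmetric `J₀`-anti-invariant form is invariant under adjacent transpositions of its
arguments, and replacing a leading pair `e₁, e₁` by `e₂, e₂` changes its sign. -/
lemma swap_and_neg_of_symm_of_anti {S : ℝ × ℝ → ℝ × ℝ → ℝ × ℝ → ℝ × ℝ → ℝ}
    (hsymm : ∀ (v : Fin 4 → ℝ × ℝ) (σ : Equiv.Perm (Fin 4)),
      S (v (σ 0)) (v (σ 1)) (v (σ 2)) (v (σ 3)) = S (v 0) (v 1) (v 2) (v 3))
    (hanti : ∀ X Y Z W : ℝ × ℝ, S (J0 X) (J0 Y) Z W = -S X Y Z W) :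
    (∀ a b c d, S b a c d = S a b c d) ∧ (∀ a b c d, S a c b d = S a b c d) ∧
      (∀ a b c d, S a b d c = S a b c d) ∧
      ∀ Z W, S (0, 1) (0, 1) Z W = -S (1, 0) (1, 0) Z W := by
  refine ⟨fun a b c d => ?_, fun a b c d => ?_, fun a b c d => ?_, fun Z W => ?_⟩
  · exact hsymm ![a, b, c, d] (Equiv.swap 0 1)
  · exact hsymm ![a, b, c, d] (Equiv.swap 1 2)
  · exact hsymm ![a, b, c, d] (Equiv.swap 2 3)
  · simpa [J0] using hanti (1, 0) (1, 0) Z W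

/-- For a `C¹` family of totally symmetric quadrilinear forms `T_p`
on `ℝ²` with `T_p(J₀X, J₀Y, Z, W) = −T_p(X,Y,Z,W)`, the Codazzi equations
`∂ₓ(T_p(e₂,a,b,c)) = ∂_y(T_p(e₁,a,b,c))` for all basis vectors `a,b,c` hold on `ℝ²`
iff `f(x+iy) = T_{(x,y)}(e₁,e₁,e₁,e₁) − i·T_{(x,y)}(e₁,e₁,e₁,e₂)` is holomorphic. -/
theorem codazzi_iff_holomorphic
    (T : ℝ × ℝ → (ℝ × ℝ) → (ℝ × ℝ) → (ℝ × ℝ) → (ℝ × ℝ) → ℝ)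
    (hC1 : ∀ a b c d : ℝ × ℝ, ContDiff ℝ 1 (fun p => T p a b c d))
    (hsymm : ∀ (p : ℝ × ℝ) (v : Fin 4 → ℝ × ℝ) (σ : Equiv.Perm (Fin 4)),
      T p (v (σ 0)) (v (σ 1)) (v (σ 2)) (v (σ 3)) = T p (v 0) (v 1) (v 2) (v 3))
    (hanti : ∀ (p : ℝ × ℝ) (X Y Z W : ℝ × ℝ),
      T p (J0 X) (J0 Y) Z W = - T p X Y Z W)
    (f : ℂ → ℂ)
    (hf : ∀ z : ℂ,
      f z = (T (z.re, z.im) (1, 0) (1, 0) (1, 0) (1, 0) : ℂ)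
          - Complex.I * (T (z.re, z.im) (1, 0) (1, 0) (1, 0) (0, 1) : ℂ)) :
    (∀ (p : ℝ × ℝ), ∀ a ∈ ({(1, 0), (0, 1)} : Set (ℝ × ℝ)),
      ∀ b ∈ ({(1, 0), (0, 1)} : Set (ℝ × ℝ)), ∀ c ∈ ({(1, 0), (0, 1)} : Set (ℝ × ℝ)),
        fderiv ℝ (fun q => T q (0, 1) a b c) p (1, 0)
          = fderiv ℝ (fun q => T q (1, 0) a b c) p (0, 1)) ↔
    (∀ z : ℂ, DifferentiableAt ℂ f z) := by
  set e₁ : ℝ × ℝ := (1, 0) with he₁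
  set e₂ : ℝ × ℝ := (0, 1) with he₂
  have hcomp p := swap_and_neg_of_symm_of_anti (hsymm p) (hanti p)
  have h01 p := (hcomp p).1
  have h12 p := (hcomp p).2.1
  have h23 p := (hcomp p).2.2.1
  have h22 p := (hcomp p).2.2.2
  simp only [← he₁, ← he₂] at h22
  have hA := (hC1 e₁ e₁ e₁ e₁).differentiable one_ne_zero
  have hB := (hC1 e₁ e₁ e₁ e₂).differentiable one_ne_zero
  have key z := differentiableAt_sub_I_mul_iff hf z (hA _) (hB _)
  have t2111 : (fun q => T q e₂ e₁ e₁ e₁) = fun q => T q e₁ e₁ e₁ e₂ := by grind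
  have t1211 : (fun q => T q e₁ e₂ e₁ e₁) = fun q => T q e₁ e₁ e₁ e₂ := by grind
  have t1121 : (fun q => T q e₁ e₁ e₂ e₁) = fun q => T q e₁ e₁ e₁ e₂ := by grind
  have t2211 : (fun q => T q e₂ e₂ e₁ e₁) = fun q => -T q e₁ e₁ e₁ e₁ := by grind
  have t2121 : (fun q => T q e₂ e₁ e₂ e₁) = fun q => -T q e₁ e₁ e₁ e₁ := by grind
  have t2112 : (fun q => T q e₂ e₁ e₁ e₂) = fun q => -T q e₁ e₁ e₁ e₁ := by grind
  have t1221 : (fun q => T q e₁ e₂ e₂ e₁) = fun q => -T q e₁ e₁ e₁ e₁ := by grind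
  have t1212 : (fun q => T q e₁ e₂ e₁ e₂) = fun q => -T q e₁ e₁ e₁ e₁ := by grind
  have t1122 : (fun q => T q e₁ e₁ e₂ e₂) = fun q => -T q e₁ e₁ e₁ e₁ := by grind
  have t2221 : (fun q => T q e₂ e₂ e₂ e₁) = fun q => -T q e₁ e₁ e₁ e₂ := by grind
  have t2212 : (fun q => T q e₂ e₂ e₁ e₂) = fun q => -T q e₁ e₁ e₁ e₂ := by grind
  have t2122 : (fun q => T q e₂ e₁ e₂ e₂) = fun q => -T q e₁ e₁ e₁ e₂ := by grind
  have t1222 : (fun q => T q e₁ e₂ e₂ e₂) = fun q => -T q e₁ e₁ e₁ e₂ := by grind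
  have t2222 : (fun q => T q e₂ e₂ e₂ e₂) = fun q => T q e₁ e₁ e₁ e₁ := by grind
  simp only [Set.mem_insert_iff, Set.mem_singleton_iff, forall_eq_or_imp, forall_eq, t2111, t1211,
    t1121, t2211, t2121, t2112, t1221, t1212, t1122, t2221, t2212, t2122, t1222, t2222,
    fderiv_fun_neg, neg_apply, key]
  constructor
  · intro h z
    have := h (z.re, z.im)
    grind
  · intro h p
    have := h ⟨p.1, p.2⟩
    grind
end

section
/- Let η : ℝ⁵ × ℝ⁵ → ℝ be the symmetric bilinear form of signature (2,3) given by η(a,b) = a₁b₁ + a₂b₂ − a₃b₃ − a₄b₄ − a₅b₅, and let f₀ : ℝ² → ℝ⁵ be defined by f₀(x,y) = (1/2)(√2·sinh(2y), √2·sinh(2x), cosh(2x)+cosh(2y), cosh(2x)−cosh(2y), 0). Then for all (x,y) ∈ ℝ²: η(f₀(x,y), f₀(x,y)) = −1 (so f₀ takes values in the quadric model of the pseudo-hyperbolic space ℍ^{2,2}), and the partial derivatives satisfy η(∂ₓf₀, ∂ₓf₀) = η(∂_yf₀, ∂_yf₀) = 2 and η(∂ₓf₀, ∂_yf₀) = 0;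 in particular f₀ is a conformal space-like immersion whose induced metric 2(dx² + dy²) is flat. -/
/-- The standard bilinear form of signature `(2,3)` on `ℝ⁵`. -/
noncomputable def eta (a b : Fin 5 → ℝ) : ℝ :=
  a 0 * b 0 + a 1 * b 1 - a 2 * b 2 - a 3 * b 3 - a 4 * b 4

/-- The explicit parameterization of the standard Barbot (horospherical) surface. -/
noncomputable def f0 : ℝ × ℝ → (Fin 5 → ℝ) := fun p =>
  (1 / 2 : ℝ) • ![Real.sqrt 2 * Real.sinh (2 * p.2),
    Real.sqrt 2 * Real.sinh (2 * p.1),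
    Real.cosh (2 * p.1) + Real.cosh (2 * p.2),
    Real.cosh (2 * p.1) - Real.cosh (2 * p.2), 0]

/-- The differential of the Barbot parameterization. -/
theorem fderiv_f0_apply (p v : ℝ × ℝ) :
    fderiv ℝ f0 p v =
      ![Real.sqrt 2 * Real.cosh (2 * p.2) * v.2,
        Real.sqrt 2 * Real.cosh (2 * p.1) * v.1,
        Real.sinh (2 * p.1) * v.1 + Real.sinh (2 * p.2) * v.2,
        Real.sinh (2 * p.1) * v.1 - Real.sinh (2 * p.2) * v.2, 0] := by
  have hx : HasFDerivAt (fun q : ℝ × ℝ => 2 * q.1) ((2 : ℝ) • ContinuousLinearMap.fst ℝ ℝ ℝ) p :=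
    hasFDerivAt_fst.const_mul 2
  have hy : HasFDerivAt (fun q : ℝ × ℝ => 2 * q.2) ((2 : ℝ) • ContinuousLinearMap.snd ℝ ℝ ℝ) p :=
    hasFDerivAt_snd.const_mul 2
  have h0 := (hy.sinh.const_mul (Real.sqrt 2)).const_mul (1 / 2)
  have h1 := (hx.sinh.const_mul (Real.sqrt 2)).const_mul (1 / 2)
  have h2 := (hx.cosh.add hy.cosh).const_mul (1 / 2)
  have h3 := (hx.cosh.sub hy.cosh).const_mul (1 / 2)
  have hd : DifferentiableAt ℝ f0 p := by
    refine differentiableAt_pi.2 fun i => ?_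
    fin_cases i
    · exact h0.differentiableAt
    · exact h1.differentiableAt
    · exact h2.differentiableAt
    · exact h3.differentiableAt
    · exact (differentiableAt_const (1 / 2 * 0 : ℝ) : DifferentiableAt ℝ (fun _ : ℝ × ℝ => (1 / 2 * 0 : ℝ)) p)
  have hcoord (i : Fin 5) : fderiv ℝ f0 p v i = fderiv ℝ (fun q => f0 q i) p v := by
    rw [fderiv_apply hd]
    rfl
  ext i
  rw [hcoord]
  fin_cases i
  · refine (congrArg (fun L => L v) h0.fderiv).trans ?_
    simp
    ring
  · refine (congrArg (fun L => L v) h1.fderiv).trans ?_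
    simp
    ring
  · refine (congrArg (fun L => L v) h2.fderiv).trans ?_
    simp
    ring
  · refine (congrArg (fun L => L v) h3.fderiv).trans ?_
    simp
    ring
  · simp [f0]

/-- `f₀` takes values in the quadric `{η(a,a) = −1}` (the model of
`ℍ^{2,2}`), and its partial derivatives satisfy `η(∂ₓf₀,∂ₓf₀) = η(∂_yf₀,∂_yf₀) = 2`
and `η(∂ₓf₀,∂_yf₀) = 0`, so `f₀` is a conformal space-like immersion with flat
induced metric `2(dx² + dy²)`. -/
theorem barbot_parametrization_conformal_flat (p : ℝ × ℝ) :
    eta (f0 p) (f0 p) = -1 ∧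
    eta (fderiv ℝ f0 p (1, 0)) (fderiv ℝ f0 p (1, 0)) = 2 ∧
    eta (fderiv ℝ f0 p (0, 1)) (fderiv ℝ f0 p (0, 1)) = 2 ∧
    eta (fderiv ℝ f0 p (1, 0)) (fderiv ℝ f0 p (0, 1)) = 0 := by
  have hs : Real.sqrt 2 ^ 2 = 2 := Real.sq_sqrt (by norm_num)
  have hx := Real.cosh_sq (2 * p.1)
  have hy := Real.cosh_sq (2 * p.2)
  refine ⟨?_, ?_, ?_, ?_⟩
  · simp [eta, f0]
    ring_nf at *
    rw [hs, hx, hy]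
    ring
  all_goals
    simp only [fderiv_f0_apply]
    simp [eta]
  · linear_combination Real.cosh (2 * p.1) ^ 2 * hs + 2 * hx
  · linear_combination Real.cosh (2 * p.2) ^ 2 * hs + 2 * hy
end

section
/- Let A be a 2×2 real matrix with entries a,b,c,d and det A = 1, and let z = x+iy with y > 0. For w in the upper half-plane let j(w) be the 2×2 real matrix with rows (Re(w)/Im(w), −|w|²/Im(w)) and (1/Im(w), −Re(w)/Im(w)). Then j((az+b)/(cz+d)) = A · j(z) · A⁻¹; that is, j is equivariant for the Möbius action of SL(2,ℝ) on the upper half-plane and the conjugation action on 2×2 matrices. -/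
open Matrix

/-- The map `j : ℍ² → 𝒥(ℝ²)`, written as a function of a complex number. -/
noncomputable def jC (z : ℂ) : Matrix (Fin 2) (Fin 2) ℝ :=
  !![z.re / z.im, -(z.re ^ 2 + z.im ^ 2) / z.im; 1 / z.im, -z.re / z.im]

/-- Real part, imaginary part and squared modulus of a Möbius image of `z`. -/
lemma re_im_div_of_real_coeff {a b c d : ℝ} (hdet : a * d - b * c = 1) (z : ℂ) :
    (((a : ℂ) * z + b) / ((c : ℂ) * z + d)).re
        = ((a * z.re + b) * (c * z.re + d) + a * c * z.im ^ 2)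
          / ((c * z.re + d) ^ 2 + (c * z.im) ^ 2) ∧
    (((a : ℂ) * z + b) / ((c : ℂ) * z + d)).im
        = z.im / ((c * z.re + d) ^ 2 + (c * z.im) ^ 2) ∧
    (((a : ℂ) * z + b) / ((c : ℂ) * z + d)).re ^ 2
        + (((a : ℂ) * z + b) / ((c : ℂ) * z + d)).im ^ 2
        = ((a * z.re + b) ^ 2 + (a * z.im) ^ 2)
          / ((c * z.re + d) ^ 2 + (c * z.im) ^ 2) := by
  have hnum : Complex.normSq ((a : ℂ) * z + b) = (a * z.re + b) ^ 2 + (a * z.im) ^ 2 := by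
    simp [Complex.normSq_apply]; ring
  have hden : Complex.normSq ((c : ℂ) * z + d) = (c * z.re + d) ^ 2 + (c * z.im) ^ 2 := by
    simp [Complex.normSq_apply]; ring
  refine ⟨?_, ?_, ?_⟩
  · rw [Complex.div_re, hden, ← add_div]
    congr 1
    simp
    ring
  · rw [Complex.div_im, hden, ← sub_div]
    congr 1
    simp
    linear_combination z.im * hdet
  · rw [← hnum, ← hden, ← Complex.normSq_div, Complex.normSq_apply]
    ring

/-- `j` is equivariant for the Möbius action of `SL(2,ℝ)` on the upper
half-plane and the conjugation action on 2×2 matrices: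
`j((az+b)/(cz+d)) = A·j(z)·A⁻¹` for `A = [[a,b],[c,d]]` with `det A = 1`. -/
theorem jC_sl2_equivariant (a b c d : ℝ) (hdet : a * d - b * c = 1)
    (z : ℂ) (hz : 0 < z.im) :
    jC (((a : ℂ) * z + (b : ℂ)) / ((c : ℂ) * z + (d : ℂ)))
      = !![a, b; c, d] * jC z * (!![a, b; c, d])⁻¹ := by
  have hN : (c * z.re + d) ^ 2 + (c * z.im) ^ 2 ≠ 0 := by
    intro h
    have hcy : c * z.im = 0 := by nlinarith [sq_nonneg (c * z.re + d), sq_nonneg (c * z.im)]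
    have hc : c = 0 := (mul_eq_zero.mp hcy).resolve_right hz.ne'
    have hd : d = 0 := by simpa [hc] using h
    simp [hc, hd] at hdet
  obtain ⟨hre, him, hsq⟩ := re_im_div_of_real_coeff hdet z
  have hinv : (!![a, b; c, d])⁻¹ = !![d, -b; -c, a] := by
    rw [Matrix.inv_def, Matrix.det_fin_two_of, hdet, Matrix.adjugate_fin_two_of]
    simp
  have hy := hz.ne'
  rw [hinv, jC, hsq, hre, him, jC, Matrix.mul_fin_two, Matrix.mul_fin_two]
  simp only [← neg_div, div_div_div_cancel_right₀ hN, one_div_div]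
  ext i j
  fin_cases i <;> fin_cases j <;> simp <;> field_simp <;> ring
end

section
/- Let j : {(x,y) ∈ ℝ² : y > 0} → M₂(ℝ) be the map j(x,y) = [[x/y, −(x²+y²)/y],[1/y, −x/y]], and let Dj_p denote its Fréchet derivative at p = (x,y). Then for all tangent vectors v = (v₁,v₂), w = (w₁,w₂) ∈ ℝ²: (1/2)tr(Dj_p(v) · Dj_p(w)) = (v₁w₁ + v₂w₂)/y² and −(1/2)tr(Dj_p(v) · j(p) · Dj_p(w)) = −(v₁w₂ − v₂w₁)/y². That is, j pulls back the metric ⟨Ȧ,Ḃ⟩ = (1/2)tr(ȦḂ) and the symplectic form Ω_J(Ȧ,Ḃ) = −(1/2)tr(ȦJḂ) on 𝒥(ℝ²) to the hyperbolic metric (dx²+dy²)/y² and the form −dx∧dy/y² on the upper half-plane. -/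
open Matrix

/-- The map `j` from the upper half-plane to `2×2` matrices, as a map between
normed spaces (matrices regarded as `Fin 2 → Fin 2 → ℝ`). -/
noncomputable def jfun : ℝ × ℝ → (Fin 2 → Fin 2 → ℝ) := fun p =>
  ![![p.1 / p.2, -(p.1 ^ 2 + p.2 ^ 2) / p.2], ![1 / p.2, -p.1 / p.2]]

/-- The derivative of a quotient by the second coordinate, evaluated on a vector. -/
theorem hasFDerivAt_div_snd {f : ℝ × ℝ → ℝ} {f' : ℝ × ℝ →L[ℝ] ℝ} {p : ℝ × ℝ}
    (hf : HasFDerivAt f f' p) (hy : p.2 ≠ 0) :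
    HasFDerivAt (fun q => f q / q.2)
      ((p.2)⁻¹ • f' - (f p / p.2 ^ 2) • ContinuousLinearMap.snd ℝ ℝ ℝ) p := by
  have h := hf.mul ((hasDerivAt_inv hy).comp_hasFDerivAt p
    (hasFDerivAt_snd (𝕜 := ℝ) (E := ℝ) (F := ℝ) (p := p)))
  refine h.congr_fderiv ?_
  ext <;> simp; ring

/-- A pair of differentiable maps, regarded as a vector-valued map, is differentiable. -/
theorem HasFDerivAt.vecCons_pair {E F : Type*} [NormedAddCommGroup E] [NormedSpace ℝ E]
    [NormedAddCommGroup F] [NormedSpace ℝ F] {f g : E → F} {f' g' : E →L[ℝ] F} {p : E}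
    (hf : HasFDerivAt f f' p) (hg : HasFDerivAt g g' p) :
    HasFDerivAt (fun q => ![f q, g q]) (ContinuousLinearMap.pi ![f', g']) p :=
  hasFDerivAt_pi'.2 <| Fin.forall_fin_two.2 ⟨hf, hg⟩

/-- The derivative of `j` in the direction `v`. -/
theorem fderiv_jfun_apply {p : ℝ × ℝ} (hy : p.2 ≠ 0) (v : ℝ × ℝ) :
    fderiv ℝ jfun p v =
      ![![v.1 / p.2 - p.1 * v.2 / p.2 ^ 2,
          -(2 * p.1 * v.1 + 2 * p.2 * v.2) / p.2 + (p.1 ^ 2 + p.2 ^ 2) * v.2 / p.2 ^ 2],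
        ![-v.2 / p.2 ^ 2, -v.1 / p.2 + p.1 * v.2 / p.2 ^ 2]] := by
  have h1 := hasFDerivAt_fst (𝕜 := ℝ) (E := ℝ) (F := ℝ) (p := p)
  have h2 := hasFDerivAt_snd (𝕜 := ℝ) (E := ℝ) (F := ℝ) (p := p)
  have ha := hasFDerivAt_div_snd h1 hy
  have hb := hasFDerivAt_div_snd ((h1.pow 2).add (h2.pow 2)).neg hy
  have hc := hasFDerivAt_div_snd (hasFDerivAt_const (1 : ℝ) p) hy
  have hd := hasFDerivAt_div_snd h1.neg hy
  have h : HasFDerivAt jfun _ p := (ha.vecCons_pair hb).vecCons_pair (hc.vecCons_pair hd)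
  rw [h.fderiv]
  ext i k
  fin_cases i <;> fin_cases k <;> simp <;> ring

/-- the derivative of `j` pulls back the scalar product
`⟨Ȧ,Ḃ⟩ = (1/2)tr(ȦḂ)` and the symplectic form `Ω_J(Ȧ,Ḃ) = −(1/2)tr(ȦJḂ)` on
`𝒥(ℝ²)` to the hyperbolic metric `(dx²+dy²)/y²` and the form `−dx∧dy/y²`. -/
theorem jfun_pullback_kahler (p : ℝ × ℝ) (hy : 0 < p.2) (v w : ℝ × ℝ) :
    (1 / 2 : ℝ) *
        (Matrix.of (fderiv ℝ jfun p v) * Matrix.of (fderiv ℝ jfun p w)).trace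
      = (v.1 * w.1 + v.2 * w.2) / p.2 ^ 2 ∧
    -(1 / 2 : ℝ) *
        (Matrix.of (fderiv ℝ jfun p v) * Matrix.of (jfun p)
          * Matrix.of (fderiv ℝ jfun p w)).trace
      = -(v.1 * w.2 - v.2 * w.1) / p.2 ^ 2 := by
  rw [fderiv_jfun_apply hy.ne', fderiv_jfun_apply hy.ne']
  have hy' := hy.ne'
  constructor <;>
  · simp only [Matrix.trace, Matrix.diag_apply, Matrix.mul_apply, Fin.sum_univ_two,
      Matrix.of_apply, jfun, Matrix.cons_val_zero, Matrix.cons_val_one]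
    field_simp
    ring
end

section
/- Let t ↦ J(t) be a differentiable family of 2×2 real matrices with J(t)² = −𝟙 and ρ₀(v, J(t)v) > 0 for v ≠ 0, and let t ↦ T(t) be a differentiable family of totally symmetric quadrilinear forms on ℝ² with T(t)(J(t)X, J(t)Y, Z, W) = −T(t)(X,Y,Z,W) for all X,Y,Z,W. Let U(t) be determined by g_{J(t)}(U(t)(X,Y)Z, W) = T(t)(X,Y,Z,W), and define U̇ by g_{J(0)}(U̇(X,Y)Z, W) = Ṫ(0)(X,Y,Z,W). Then for all X,Y ∈ ℝ²: tr(U̇(X,Y)) = −tr(J(0)·J̇(0)·U(0)(X,Y)), where J̇(0) is the derivative of J(t) at t = 0. -/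
open Matrix

/-- The standard area form on `ℝ²`. -/
noncomputable def rho0 (v w : Fin 2 → ℝ) : ℝ := v 0 * w 1 - v 1 * w 0

/-- The scalar product `g_J(v,w) = ρ₀(v, Jw)` associated with a compatible linear
complex structure `J`. -/
noncomputable def gJ (J : Matrix (Fin 2) (Fin 2) ℝ) (v w : Fin 2 → ℝ) : ℝ :=
  rho0 v (J.mulVec w)

/-- A real `2 × 2` matrix squaring to `-1` has zero trace, determinant one and nonzero
upper right entry. -/
theorem entries_of_sq_eq_neg_one (J : Matrix (Fin 2) (Fin 2) ℝ) (h : J * J = -1) :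
    J 1 1 = -J 0 0 ∧ J 0 0 ^ 2 + J 0 1 * J 1 0 = -1 ∧ J 0 1 ≠ 0 := by
  have h00 := congrFun (congrFun h 0) 0
  have h01 := congrFun (congrFun h 0) 1
  simp only [Matrix.mul_apply, Fin.sum_univ_two, Matrix.neg_apply, Matrix.one_apply_eq] at h00
  simp [Matrix.mul_apply, Fin.sum_univ_two] at h01
  have hb : J 0 1 ≠ 0 := by
    intro hb
    rw [hb] at h00
    nlinarith [sq_nonneg (J 0 0)]
  refine ⟨?_, by linarith, hb⟩
  have : J 0 1 * (J 1 1 + J 0 0) = 0 := by linarith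
  rcases mul_eq_zero.mp this with h' | h'
  · exact absurd h' hb
  · linarith

/-- Coordinate expression of `g_J`. -/
theorem gJ_mulVec_eq (J M : Matrix (Fin 2) (Fin 2) ℝ) (Z W : Fin 2 → ℝ) :
    gJ J (M.mulVec Z) W
      = (M 0 0 * Z 0 + M 0 1 * Z 1) * (J 1 0 * W 0 + J 1 1 * W 1)
        - (M 1 0 * Z 0 + M 1 1 * Z 1) * (J 0 0 * W 0 + J 0 1 * W 1) := by
  simp [gJ, rho0, Matrix.mulVec, dotProduct, Fin.sum_univ_two]

/-- If the bilinear form `g_J(M·,·)` is anti-invariant under `J`, then `M` is trace-free. -/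
theorem trace_eq_zero_of_gJ_anti (J M : Matrix (Fin 2) (Fin 2) ℝ) (h : J * J = -1)
    (hM : ∀ Z W, gJ J (M.mulVec (J.mulVec Z)) (J.mulVec W) = -gJ J (M.mulVec Z) W) :
    M 0 0 + M 1 1 = 0 := by
  obtain ⟨hd, hdet, hb⟩ := entries_of_sq_eq_neg_one J h
  have h11 := hM ![0, 1] ![0, 1]
  simp only [gJ_mulVec_eq] at h11
  simp [Matrix.mulVec, dotProduct, Fin.sum_univ_two, hd] at h11
  refine (mul_eq_zero.mp ?_).resolve_left hb
  linear_combination -h11 + (M 0 0 * J 0 1 - M 0 1 * J 0 0) * hdet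

/-- The trace of `M` in terms of the bilinear form `g_J(M·,·)`. -/
theorem trace_eq_gJ (J M : Matrix (Fin 2) (Fin 2) ℝ) (h : J * J = -1) :
    M 0 0 + M 1 1 = -(J 0 1 * gJ J (M.mulVec ![1, 0]) ![1, 0])
      + J 0 0 * (gJ J (M.mulVec ![1, 0]) ![0, 1] + gJ J (M.mulVec ![0, 1]) ![1, 0])
      + J 1 0 * gJ J (M.mulVec ![0, 1]) ![0, 1] := by
  obtain ⟨hd, hdet, -⟩ := entries_of_sq_eq_neg_one J h
  simp only [gJ_mulVec_eq]
  simp [hd]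
  linear_combination (M 0 0 + M 1 1) * hdet

/-- for a differentiable family `(J(t), T(t))` of points of `𝓜(ℝ²)`
with `U(t) = g_{J(t)}⁻¹ T(t)` and `U̇ = g_{J(0)}⁻¹ Ṫ(0)`, one has
`tr(U̇(X,Y)) = −tr(J(0)·J̇(0)·U(0)(X,Y))` for all `X,Y ∈ ℝ²`. -/
theorem trace_Udot_eq_neg_trace_JJdotU
    (J : ℝ → Fin 2 → Fin 2 → ℝ) (hJdiff : DifferentiableAt ℝ J 0)
    (hJ2 : ∀ t : ℝ, Matrix.of (J t) * Matrix.of (J t) = -1)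
    (hJpos : ∀ (t : ℝ) (v : Fin 2 → ℝ), v ≠ 0 →
      0 < rho0 v ((Matrix.of (J t)).mulVec v))
    (T : ℝ → (Fin 2 → ℝ) → (Fin 2 → ℝ) → (Fin 2 → ℝ) → (Fin 2 → ℝ) → ℝ)
    (hTdiff : ∀ X Y Z W : Fin 2 → ℝ, DifferentiableAt ℝ (fun t => T t X Y Z W) 0)
    (hsymm : ∀ (t : ℝ) (v : Fin 4 → (Fin 2 → ℝ)) (σ : Equiv.Perm (Fin 4)),
      T t (v (σ 0)) (v (σ 1)) (v (σ 2)) (v (σ 3)) = T t (v 0) (v 1) (v 2) (v 3))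
    (hanti : ∀ (t : ℝ) (X Y Z W : Fin 2 → ℝ),
      T t ((Matrix.of (J t)).mulVec X) ((Matrix.of (J t)).mulVec Y) Z W
        = -T t X Y Z W)
    (U : ℝ → (Fin 2 → ℝ) → (Fin 2 → ℝ) → Matrix (Fin 2) (Fin 2) ℝ)
    (hU : ∀ (t : ℝ) (X Y Z W : Fin 2 → ℝ),
      gJ (Matrix.of (J t)) ((U t X Y).mulVec Z) W = T t X Y Z W)
    (Udot : (Fin 2 → ℝ) → (Fin 2 → ℝ) → Matrix (Fin 2) (Fin 2) ℝ)
    (hUdot : ∀ X Y Z W : Fin 2 → ℝ,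
      gJ (Matrix.of (J 0)) ((Udot X Y).mulVec Z) W
        = deriv (fun t => T t X Y Z W) 0) :
    ∀ X Y : Fin 2 → ℝ,
      (Udot X Y).trace
        = -(Matrix.of (J 0) * Matrix.of (deriv J 0) * U 0 X Y).trace := by
  intro X Y
  have hanti' : ∀ t X Y Z W, T t X Y ((Matrix.of (J t)).mulVec Z) ((Matrix.of (J t)).mulVec W)
      = -T t X Y Z W := by
    intro t X Y Z W
    have hswap : ∀ A B C D, T t C D A B = T t A B C D := fun A B C D => by
      exact hsymm t ![A, B, C, D] (Equiv.swap 0 2 * Equiv.swap 1 3)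
    rw [hswap, hanti, hswap]
  have htr : ∀ t, U t X Y 0 0 + U t X Y 1 1 = 0 := fun t =>
    trace_eq_zero_of_gJ_anti _ _ (hJ2 t) fun Z W => by
      rw [hU, hU, hanti']
  have hJd : ∀ i j, HasDerivAt (fun t => J t i j) (deriv J 0 i j) 0 := fun i j =>
    hasDerivAt_pi.mp (hasDerivAt_pi.mp hJdiff.hasDerivAt i) j
  have hTd : ∀ Z W, HasDerivAt (fun t => T t X Y Z W)
      (gJ (Matrix.of (J 0)) ((Udot X Y).mulVec Z) W) 0 := fun Z W => by
    rw [hUdot]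
    exact (hTdiff X Y Z W).hasDerivAt
  have hd' : deriv J 0 1 1 = -deriv J 0 0 0 := by
    refine (hJd 1 1).unique ?_
    have : (fun t => J t 1 1) = fun t => -J t 0 0 :=
      funext fun t => (entries_of_sq_eq_neg_one _ (hJ2 t)).1
    rw [this]
    exact (hJd 0 0).neg
  have hd := (entries_of_sq_eq_neg_one _ (hJ2 0)).1
  have hzero : (fun t => -(J t 0 1 * T t X Y ![1, 0] ![1, 0])
      + J t 0 0 * (T t X Y ![1, 0] ![0, 1] + T t X Y ![0, 1] ![1, 0])
      + J t 1 0 * T t X Y ![0, 1] ![0, 1]) = fun _ => 0 := by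
    funext t
    have := trace_eq_gJ _ (U t X Y) (hJ2 t)
    rw [htr t] at this
    simp only [hU, Matrix.of_apply] at this
    exact this.symm
  have hder := (((hJd 0 1).mul (hTd ![1, 0] ![1, 0])).neg.add
    ((hJd 0 0).mul ((hTd ![1, 0] ![0, 1]).add (hTd ![0, 1] ![1, 0])))).add
    ((hJd 1 0).mul (hTd ![0, 1] ![0, 1]))
  have hkey := hder.unique ((hasDerivAt_const (0 : ℝ) (0 : ℝ)).congr_of_eventuallyEq
    (Filter.Eventually.of_forall (congrFun hzero)))
  have hN := trace_eq_gJ _ (Udot X Y) (hJ2 0)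
  simp only [Pi.add_apply, ← hU 0, gJ_mulVec_eq] at hkey
  simp only [gJ_mulVec_eq] at hN
  simp only [Matrix.of_apply] at hd hkey hN
  simp [hd] at hkey hN
  simp only [Matrix.trace_fin_two, Matrix.mul_apply, Fin.sum_univ_two, Matrix.of_apply, hd, hd']
  linear_combination hN + hkey + (J 0 0 1 * deriv J 0 1 0 + J 0 1 0 * deriv J 0 0 1
    + 2 * J 0 0 0 * deriv J 0 0 0) * htr 0
end

section
/- Let y, u, v, F, F' be real numbers with y ≠ 0, and let G be the 4×4 real matrix with rows: ((1−F+4(u²+v²)y⁴F')/y², 0, 2F'vy³, −2F'uy³), (0, (1−F+4(u²+v²)y⁴F')/y², 2F'uy³, 2F'vy³), (2F'vy³, 2F'uy³, F'y⁴, 0), (−2F'uy³, 2F'vy³, 0, F'y⁴). Then det G = y⁴·(F')²·(1−F)². In particular, if F' ≠ 0 and F ≠ 1 then G is non-degenerate. -/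
open Matrix

/-- The matrix of the pseudo-Riemannian metric `g_f` at a point of `ℍ² × ℂ` in the
coordinates `(x,y,u,v)`, with `F = f(y⁴(u²+v²))` and `F' = f'(y⁴(u²+v²))`. -/
noncomputable def Gmat (y u v F F' : ℝ) : Matrix (Fin 4) (Fin 4) ℝ :=
  !![(1 - F + 4 * (u ^ 2 + v ^ 2) * y ^ 4 * F') / y ^ 2, 0,
      2 * F' * v * y ^ 3, -2 * F' * u * y ^ 3;
    0, (1 - F + 4 * (u ^ 2 + v ^ 2) * y ^ 4 * F') / y ^ 2,
      2 * F' * u * y ^ 3, 2 * F' * v * y ^ 3;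
    2 * F' * v * y ^ 3, 2 * F' * u * y ^ 3, F' * y ^ 4, 0;
    -2 * F' * u * y ^ 3, 2 * F' * v * y ^ 3, 0, F' * y ^ 4]

/-- `det G = y⁴·(F')²·(1−F)²`; in particular, if `F' ≠ 0` and
`F ≠ 1` then `G` is non-degenerate. -/
theorem Gmat_det (y u v F F' : ℝ) (hy : y ≠ 0) :
    (Gmat y u v F F').det = y ^ 4 * F' ^ 2 * (1 - F) ^ 2 ∧
    (F' ≠ 0 → F ≠ 1 → (Gmat y u v F F').det ≠ 0) := by
  have hdet : (Gmat y u v F F').det = y ^ 4 * F' ^ 2 * (1 - F) ^ 2 := by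
    simp [Gmat, det_succ_row_zero, Fin.sum_univ_succ, Fin.succAbove]
    field_simp
    ring
  refine ⟨hdet, fun hF' hF => ?_⟩
  have hF1 : 1 - F ≠ 0 := sub_ne_zero.mpr hF.symm
  rw [hdet]
  positivity
end

section
/- Let f : ℝ → ℝ be a C² function. On the open set {(x,y,u,v) ∈ ℝ⁴ : y > 0}, write F = f(y⁴(u²+v²)), F' = f'(y⁴(u²+v²)), and define the antisymmetric coefficient functions of the 2-form ω_f (in the coordinates x₁=x, x₂=y, x₃=u, x₄=v) by: Ω₁₂ = (−1+F−4F'y⁴(u²+v²))/y², Ω₃₄ = −F'y⁴, Ω₁₃ = −2y³F'u, Ω₂₄ = −2y³F'u, Ω₂₃ = 2y³F'v, Ω₁₄ = −2y³F'v, and Ω_{ji} = −Ω_{ij}. Then for all indices 1 ≤ i < j < k ≤ 4, the identity ∂ᵢΩ_{jk} − ∂ⱼΩ_{ik} + ∂ₖΩ_{ij} = 0 holds on {y > 0}; that is, the 2-form ω_f is closed. -/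
open Matrix

/-- The antisymmetric coefficient matrix `(Ω_{ij}(p))` of the 2-form `ω_f` at the
point `p = (x,y,u,v)`, with `F = f(y⁴(u²+v²))` and `F' = f'(y⁴(u²+v²))`:
`Ω₁₂ = (−1+F−4F'y⁴(u²+v²))/y²`, `Ω₃₄ = −F'y⁴`, `Ω₁₃ = Ω₂₄ = −2y³F'u`,
`Ω₂₃ = 2y³F'v`, `Ω₁₄ = −2y³F'v`, and `Ω_{ji} = −Ω_{ij}`. -/
noncomputable def Om (f : ℝ → ℝ) (p : Fin 4 → ℝ) : Matrix (Fin 4) (Fin 4) ℝ :=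
  let y := p 1
  let u := p 2
  let v := p 3
  let F := f (y ^ 4 * (u ^ 2 + v ^ 2))
  let F' := deriv f (y ^ 4 * (u ^ 2 + v ^ 2))
  !![0, (-1 + F - 4 * F' * y ^ 4 * (u ^ 2 + v ^ 2)) / y ^ 2,
      -2 * y ^ 3 * F' * u, -2 * y ^ 3 * F' * v;
    -((-1 + F - 4 * F' * y ^ 4 * (u ^ 2 + v ^ 2)) / y ^ 2), 0,
      2 * y ^ 3 * F' * v, -2 * y ^ 3 * F' * u;
    2 * y ^ 3 * F' * u, -(2 * y ^ 3 * F' * v), 0, -(F' * y ^ 4);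
    2 * y ^ 3 * F' * v, 2 * y ^ 3 * F' * u, F' * y ^ 4, 0]

/-- Chain rule for `g` composed with `(x, y, u, v) ↦ y⁴(u² + v²)`. -/
theorem hasFDerivAt_comp_radial {g : ℝ → ℝ} {p : Fin 4 → ℝ}
    (hg : DifferentiableAt ℝ g (p 1 ^ 4 * (p 2 ^ 2 + p 3 ^ 2))) :
    HasFDerivAt (fun q : Fin 4 → ℝ => g (q 1 ^ 4 * (q 2 ^ 2 + q 3 ^ 2)))
      (deriv g (p 1 ^ 4 * (p 2 ^ 2 + p 3 ^ 2)) •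
        ((4 * p 1 ^ 3 * (p 2 ^ 2 + p 3 ^ 2)) • ContinuousLinearMap.proj (R := ℝ) 1
          + (2 * p 1 ^ 4 * p 2) • ContinuousLinearMap.proj (R := ℝ) 2
          + (2 * p 1 ^ 4 * p 3) • ContinuousLinearMap.proj (R := ℝ) 3) :
        (Fin 4 → ℝ) →L[ℝ] ℝ) p := by
  refine HasDerivAt.comp_hasFDerivAt p hg.hasDerivAt ?_
  convert ((hasFDerivAt_apply (𝕜 := ℝ) (1 : Fin 4) p).pow 4).fun_mul
    (((hasFDerivAt_apply (𝕜 := ℝ) (2 : Fin 4) p).pow 2).fun_add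
      ((hasFDerivAt_apply (𝕜 := ℝ) (3 : Fin 4) p).pow 2)) using 1
  refine ContinuousLinearMap.ext fun w => ?_
  simp
  ring

/-- for a `C²` function `f`, the 2-form `ω_f` is closed on `{y > 0}`:
`∂ᵢΩ_{jk} − ∂ⱼΩ_{ik} + ∂ₖΩ_{ij} = 0` for all `i < j < k`. -/
theorem omega_f_closed (f : ℝ → ℝ) (hf : ContDiff ℝ 2 f)
    (p : Fin 4 → ℝ) (hp : 0 < p 1) (i j k : Fin 4) (hij : i < j) (hjk : j < k) :
    fderiv ℝ (fun q => Om f q j k) p (Pi.single i 1)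
      - fderiv ℝ (fun q => Om f q i k) p (Pi.single j 1)
      + fderiv ℝ (fun q => Om f q i j) p (Pi.single k 1) = 0 := by
  have hy := hasFDerivAt_apply (𝕜 := ℝ) (1 : Fin 4) p
  have hu := hasFDerivAt_apply (𝕜 := ℝ) (2 : Fin 4) p
  have hv := hasFDerivAt_apply (𝕜 := ℝ) (3 : Fin 4) p
  have hF := hasFDerivAt_comp_radial (p := p) (hf.differentiable (by norm_num)).differentiableAt
  have hF' := hasFDerivAt_comp_radial (p := p) hf.differentiable_deriv_two.differentiableAt
  have hy0 : p 1 ≠ 0 := hp.ne'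
  have h01 : HasFDerivAt (fun q => Om f q 0 1) _ p :=
    (((hF.const_add (-1)).fun_sub (((hF'.const_mul 4).fun_mul (hy.pow 4)).fun_mul
      ((hu.pow 2).fun_add (hv.pow 2)))).fun_mul
      ((hasDerivAt_inv (pow_ne_zero 2 hy0)).comp_hasFDerivAt p (hy.pow 2)))
  have h02 : HasFDerivAt (fun q => Om f q 0 2) _ p := (((hy.pow 3).const_mul (-2)).fun_mul hF').fun_mul hu
  have h03 : HasFDerivAt (fun q => Om f q 0 3) _ p := (((hy.pow 3).const_mul (-2)).fun_mul hF').fun_mul hv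
  have h12 : HasFDerivAt (fun q => Om f q 1 2) _ p := (((hy.pow 3).const_mul 2).fun_mul hF').fun_mul hv
  have h13 : HasFDerivAt (fun q => Om f q 1 3) _ p := (((hy.pow 3).const_mul (-2)).fun_mul hF').fun_mul hu
  have h23 : HasFDerivAt (fun q => Om f q 2 3) _ p := (hF'.fun_mul (hy.pow 4)).fun_neg
  have htriple : (i = 0 ∧ j = 1 ∧ k = 2) ∨ (i = 0 ∧ j = 1 ∧ k = 3) ∨
      (i = 0 ∧ j = 2 ∧ k = 3) ∨ (i = 1 ∧ j = 2 ∧ k = 3) := by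
    omega
  rcases htriple with ⟨rfl, rfl, rfl⟩ | ⟨rfl, rfl, rfl⟩ | ⟨rfl, rfl, rfl⟩ | ⟨rfl, rfl, rfl⟩
  · rw [h12.fderiv, h02.fderiv, h01.fderiv]
    simp
    field_simp
    ring
  · rw [h13.fderiv, h03.fderiv, h01.fderiv]
    simp
    field_simp
    ring
  · rw [h23.fderiv, h03.fderiv, h02.fderiv]
    simp
    ring
  · rw [h23.fderiv, h13.fderiv, h12.fderiv]
    simp
    ring
end

section
/- Let f : ℝ → ℝ be differentiable. On the open set {p = (x,y,u,v) ∈ ℝ⁴ : y > 0}, let ω_f(p) be the antisymmetric bilinear form on ℝ⁴ with coefficients (in coordinates x,y,u,v): Ω₁₂ = (−1+F−4F'y⁴(u²+v²))/y², Ω₃₄ = −F'y⁴, Ω₁₃ = Ω₂₄ = −2y³F'u, Ω₂₃ = 2y³F'v, Ω₁₄ = −2y³F'v, where F = f(y⁴(u²+v²)) and F' = f'(y⁴(u²+v²)). Define H₁(p) = (1/2)f(y⁴(u²+v²)) and the vector field X(p) = (0, 0, −v, u). Then for every p with y > 0 and every Y ∈ ℝ⁴: ω_f(p)(X(p), Y)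 = dH₁(p)(Y), where dH₁(p) is the Fréchet derivative of H₁ at p. In other words, H₁ is a Hamiltonian for the circle action (z,w) ↦ (z, e^{−iθ}w) with respect to ω_f. -/
open Matrix

/-- The Hamiltonian `H₁(p) = (1/2)f(y⁴(u²+v²))` of the circle action. -/
noncomputable def H1 (f : ℝ → ℝ) (p : Fin 4 → ℝ) : ℝ :=
  (1 / 2 : ℝ) * f ((p 1) ^ 4 * ((p 2) ^ 2 + (p 3) ^ 2))

/-- `H₁` is a Hamiltonian for the circle action
`(z,w) ↦ (z, e^{−iθ}w)` with respect to `ω_f`: the generator `X = (0,0,−v,u)`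
satisfies `ω_f(p)(X(p), Y) = dH₁(p)(Y)` for every `Y ∈ ℝ⁴` and every `p` with
`y > 0`. -/
theorem H1_hamiltonian_of_circle_action (f : ℝ → ℝ) (hf : Differentiable ℝ f)
    (p : Fin 4 → ℝ) (hp : 0 < p 1) (Y : Fin 4 → ℝ) :
    (![0, 0, -(p 3), p 2]) ⬝ᵥ ((Om f p).mulVec Y) = fderiv ℝ (H1 f) p Y := by
  have hproj (i : Fin 4) : HasFDerivAt (fun q : Fin 4 → ℝ => q i)
      (ContinuousLinearMap.proj (R := ℝ) (φ := fun _ : Fin 4 => ℝ) i) p :=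
    hasFDerivAt_apply i p
  have hr := ((hproj 1).pow 4).mul (((hproj 2).pow 2).add ((hproj 3).pow 2))
  have hH : HasFDerivAt (H1 f) _ p :=
    ((hf _).hasDerivAt.comp_hasFDerivAt p hr).const_mul (1 / 2 : ℝ)
  rw [hH.fderiv]
  simp [Om, Matrix.mulVec, dotProduct, Fin.sum_univ_four]
  ring
end

section
/- Let f : ℝ → ℝ be differentiable. On the open set {p = (x,y,u,v) ∈ ℝ⁴ : y > 0}, let ω_f(p) be the antisymmetric bilinear form on ℝ⁴ with coefficients (in coordinates x,y,u,v): Ω₁₂ = (−1+F−4F'y⁴(u²+v²))/y², Ω₃₄ = −F'y⁴, Ω₁₃ = Ω₂₄ = −2y³F'u, Ω₂₃ = 2y³F'v, Ω₁₄ = −2y³F'v, where F = f(y⁴(u²+v²)) and F' = f'(y⁴(u²+v²)). Define H₂(p) = 2(x/y)·(1 − f(y⁴(u²+v²))) and the vector field V(p) = (2x, 2y, −4u, −4v). Then for every p with y > 0 and every Y ∈ ℝ⁴: ω_f(p)(V(p), Y) = dH₂(p)(Y). In other words, H₂ is a Hamiltonian for the action of the diagonal subgroup ℝ* ⊂ SL(2,ℝ)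 with respect to ω_f. -/
open Matrix

/-- The Hamiltonian `H₂(p) = 2(x/y)(1 − f(y⁴(u²+v²)))` of the action of the
diagonal subgroup `ℝ* ⊂ SL(2,ℝ)`. -/
noncomputable def H2 (f : ℝ → ℝ) (p : Fin 4 → ℝ) : ℝ :=
  2 * (p 0 / p 1) * (1 - f ((p 1) ^ 4 * ((p 2) ^ 2 + (p 3) ^ 2)))

/-- The Fréchet derivative of `H2 f` on the half-space `y > 0`, evaluated on a vector. -/
theorem fderiv_H2_apply {f : ℝ → ℝ} {p : Fin 4 → ℝ}
    (hf : DifferentiableAt ℝ f (p 1 ^ 4 * (p 2 ^ 2 + p 3 ^ 2))) (hp : p 1 ≠ 0) (Y : Fin 4 → ℝ) :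
    fderiv ℝ (H2 f) p Y =
      2 * ((Y 0 * p 1 - p 0 * Y 1) / p 1 ^ 2) * (1 - f (p 1 ^ 4 * (p 2 ^ 2 + p 3 ^ 2)))
        - 2 * (p 0 / p 1) * (deriv f (p 1 ^ 4 * (p 2 ^ 2 + p 3 ^ 2)) *
          (4 * p 1 ^ 3 * Y 1 * (p 2 ^ 2 + p 3 ^ 2)
            + p 1 ^ 4 * (2 * p 2 * Y 2 + 2 * p 3 * Y 3))) := by
  have hc (i : Fin 4) := hasFDerivAt_apply (𝕜 := ℝ) i p
  have hs := ((hc 1).pow 4).mul (((hc 2).pow 2).add ((hc 3).pow 2))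
  have hH : HasFDerivAt (H2 f) _ p :=
    (((hc 0).mul ((hasDerivAt_inv hp).comp_hasFDerivAt p (hc 1))).const_mul 2).mul
      ((hf.hasDerivAt.comp_hasFDerivAt p hs).const_sub 1)
  rw [hH.fderiv]
  simp
  field_simp
  ring

/-- `H₂` is a Hamiltonian for the diagonal `ℝ*`-action with respect
to `ω_f`: the generator `V = (2x, 2y, −4u, −4v)` satisfies
`ω_f(p)(V(p), Y) = dH₂(p)(Y)` for every `Y ∈ ℝ⁴` and every `p` with `y > 0`. -/
theorem H2_hamiltonian_of_diagonal_action (f : ℝ → ℝ) (hf : Differentiable ℝ f)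
    (p : Fin 4 → ℝ) (hp : 0 < p 1) (Y : Fin 4 → ℝ) :
    (![2 * p 0, 2 * p 1, -4 * p 2, -4 * p 3]) ⬝ᵥ ((Om f p).mulVec Y)
      = fderiv ℝ (H2 f) p Y := by
  rw [fderiv_H2_apply (hf _) hp.ne']
  simp [Om, Matrix.mulVec, dotProduct, Fin.sum_univ_four]
  field_simp
  ring
end

section
/- Let f : ℝ → ℝ be differentiable with f(t) ≤ 0 and f'(t) < 0 for all t ≥ 0. On {p = (x,y,u,v) ∈ ℝ⁴ : y > 0, (u,v) ≠ (0,0)}, let ω_f(p) be the antisymmetric bilinear form with coefficients Ω₁₂ = (−1+F−4F'y⁴(u²+v²))/y², Ω₃₄ = −F'y⁴, Ω₁₃ = Ω₂₄ = −2y³F'u, Ω₂₃ = 2y³F'v, Ω₁₄ = −2y³F'v (F = f(y⁴(u²+v²)), F' = f'(y⁴(u²+v²))), and set H₁(p) = (1/2)f(y⁴(u²+v²)), H₂(p) = 2(x/y)(1−f(y⁴(u²+v²))), X₁(p) = (0,0,−v,u), X₂(p) = (2x,2y,−4u,−4v). Then at every such p: (a) ω_f(p)(X₁(p), X₂(p))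 = 0, i.e. H₁ and H₂ are in involution; (b) the Fréchet derivatives dH₁(p) and dH₂(p) are linearly independent linear functionals on ℝ⁴. Hence (𝓜𝓕(T²), ω_f, H₁) is a completely integrable Hamiltonian system with integrals of motion H₁, H₂. -/
open Matrix

/-- Derivative of the invariant `y⁴(u²+v²)`. -/
theorem hasFDerivAt_invariant (p : Fin 4 → ℝ) :
    HasFDerivAt (fun q : Fin 4 → ℝ => q 1 ^ 4 * (q 2 ^ 2 + q 3 ^ 2))
      ((4 * p 1 ^ 3 * (p 2 ^ 2 + p 3 ^ 2)) • ContinuousLinearMap.proj (R := ℝ) (1 : Fin 4) +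
        (2 * p 1 ^ 4 * p 2) • ContinuousLinearMap.proj (R := ℝ) (2 : Fin 4) +
        (2 * p 1 ^ 4 * p 3) • ContinuousLinearMap.proj (R := ℝ) (3 : Fin 4)) p := by
  have h (i : Fin 4) : HasFDerivAt (fun q : Fin 4 → ℝ => q i)
      (ContinuousLinearMap.proj (R := ℝ) i) p := hasFDerivAt_apply i p
  refine (((h 1).pow 4).mul (((h 2).pow 2).add ((h 3).pow 2))).congr_fderiv ?_
  ext w
  simp
  ring

/-- The differential of `H₁`. -/
theorem fderiv_H1_apply {f : ℝ → ℝ} (hf : Differentiable ℝ f) (p w : Fin 4 → ℝ) :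
    fderiv ℝ (H1 f) p w = (1 / 2) * deriv f (p 1 ^ 4 * (p 2 ^ 2 + p 3 ^ 2)) *
      (4 * p 1 ^ 3 * (p 2 ^ 2 + p 3 ^ 2) * w 1 + 2 * p 1 ^ 4 * p 2 * w 2 +
        2 * p 1 ^ 4 * p 3 * w 3) := by
  have h : HasFDerivAt (H1 f) _ p :=
    (((hf _).hasDerivAt.comp_hasFDerivAt p (hasFDerivAt_invariant p)).const_mul (1 / 2 : ℝ))
  rw [h.fderiv]
  simp
  ring

/-- The `x`-derivative of `H₂`. -/
theorem fderiv_H2_single_zero {f : ℝ → ℝ} (hf : Differentiable ℝ f) (p : Fin 4 → ℝ)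
    (hp : p 1 ≠ 0) :
    fderiv ℝ (H2 f) p (Pi.single 0 1) =
      2 / p 1 * (1 - f (p 1 ^ 4 * (p 2 ^ 2 + p 3 ^ 2))) := by
  have hc (i : Fin 4) : HasFDerivAt (fun q : Fin 4 → ℝ => q i)
      (ContinuousLinearMap.proj (R := ℝ) i) p := hasFDerivAt_apply i p
  have h : HasFDerivAt (H2 f) _ p :=
    (((hc 0).mul ((hasDerivAt_inv hp).comp_hasFDerivAt p (hc 1))).const_mul 2).mul
      (((hf _).hasDerivAt.comp_hasFDerivAt p (hasFDerivAt_invariant p)).const_sub 1)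
  rw [h.fderiv]
  simp
  field_simp

/-- on `𝓜𝓕(T²) ≅ {y > 0, (u,v) ≠ 0}`, with Hamiltonian vector
fields `X₁ = (0,0,−v,u)` of `H₁` and `X₂ = (2x,2y,−4u,−4v)` of `H₂`:
(a) `ω_f(X₁,X₂) = 0`, i.e. `H₁` and `H₂` are in involution;
(b) `dH₁(p)` and `dH₂(p)` are linearly independent functionals on `ℝ⁴`.
Hence `(𝓜𝓕(T²), ω_f, H₁)` is a completely integrable Hamiltonian system. -/
theorem completely_integrable_system (f : ℝ → ℝ) (hf : Differentiable ℝ f)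
    (hfle : ∀ t : ℝ, 0 ≤ t → f t ≤ 0) (hf' : ∀ t : ℝ, 0 ≤ t → deriv f t < 0)
    (p : Fin 4 → ℝ) (hp : 0 < p 1) (hw : ¬(p 2 = 0 ∧ p 3 = 0)) :
    (![0, 0, -(p 3), p 2]) ⬝ᵥ
        ((Om f p).mulVec ![2 * p 0, 2 * p 1, -4 * p 2, -4 * p 3]) = 0 ∧
    LinearIndependent ℝ ![fderiv ℝ (H1 f) p, fderiv ℝ (H2 f) p] := by
  constructor
  · simp [Om, Matrix.mulVec, dotProduct, Fin.sum_univ_four]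
    ring
  · have hs : 0 < p 2 ^ 2 + p 3 ^ 2 := by
      by_contra! h
      exact hw ⟨by nlinarith [sq_nonneg (p 2), sq_nonneg (p 3)],
        by nlinarith [sq_nonneg (p 2), sq_nonneg (p 3)]⟩
    have ht : 0 ≤ p 1 ^ 4 * (p 2 ^ 2 + p 3 ^ 2) := by positivity
    rw [LinearIndependent.pair_iff]
    intro a b hab
    have hb : b = 0 := by
      have h := DFunLike.congr_fun hab (Pi.single 0 1)
      simp only [_root_.add_apply, _root_.smul_apply,
        fderiv_H1_apply hf, fderiv_H2_single_zero hf p hp.ne'] at h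
      have hF : 2 / p 1 * (1 - f (p 1 ^ 4 * (p 2 ^ 2 + p 3 ^ 2))) ≠ 0 :=
        mul_ne_zero (by positivity) (by linarith [hfle _ ht])
      simpa [hF, -mul_eq_zero, mul_eq_zero_iff_right hF] using h
    refine ⟨?_, hb⟩
    have h := DFunLike.congr_fun hab ![0, 0, p 2, p 3]
    simp only [hb, zero_smul, add_zero, _root_.smul_apply,
      fderiv_H1_apply hf] at h
    have hF : deriv f (p 1 ^ 4 * (p 2 ^ 2 + p 3 ^ 2)) * (p 1 ^ 4 * (p 2 ^ 2 + p 3 ^ 2)) ≠ 0 :=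
      mul_ne_zero (hf' _ ht).ne (by positivity)
    refine (mul_eq_zero.mp ?_).resolve_right hF
    simp [-mul_eq_zero] at h
    linear_combination h
end
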